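/- arXiv:1904.06917 — 4 statements merged into one kernel-verified Lean document; each statement's English description precedes it below -/
import Mathlib

section
/- Let K be a field, let U and W be K-vector spaces, let f : U → W be a K-linear map, and let V ⊆ U be a linear subspace. Then the five-term sequence 0 → ker(f) ∩ V → ker(f) → U/V → W/f(V) → W/f(U) → 0 is exact, where the first map is the inclusion, the second sends u ∈ ker(f) to its class u + V in U/V, the third sends u + V to f(u) + f(V), and the fourth is the natural projection W/f(V) → W/f(U). -/
/-- The five-term sequence
`0 → ker f ∩ V → ker f → U/V → W/f(V) → W/f(U) → 0` is exact. -/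
theorem stmt1 {K U W : Type*} [Field K] [AddCommGroup U] [Module K U]
    [AddCommGroup W] [Module K W] (f : U →ₗ[K] W) (V : Submodule K U) :
    Function.Injective
      (Submodule.inclusion (inf_le_left : LinearMap.ker f ⊓ V ≤ LinearMap.ker f)) ∧
    LinearMap.range
        (Submodule.inclusion (inf_le_left : LinearMap.ker f ⊓ V ≤ LinearMap.ker f))
      = LinearMap.ker (V.mkQ ∘ₗ (LinearMap.ker f).subtype) ∧
    LinearMap.range (V.mkQ ∘ₗ (LinearMap.ker f).subtype)
      = LinearMap.ker
          (Submodule.mapQ V (V.map f) f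
            (fun x hx => Submodule.mem_comap.mpr (Submodule.mem_map_of_mem hx))) ∧
    LinearMap.range
        (Submodule.mapQ V (V.map f) f
          (fun x hx => Submodule.mem_comap.mpr (Submodule.mem_map_of_mem hx)))
      = LinearMap.ker
          (Submodule.mapQ (V.map f) (LinearMap.range f) LinearMap.id
            (fun w hw => by
              rcases hw with ⟨u, -, rfl⟩
              exact Submodule.mem_comap.mpr ⟨u, rfl⟩)) ∧
    Function.Surjective
      (Submodule.mapQ (V.map f) (LinearMap.range f) LinearMap.id
        (fun w hw => by
          rcases hw with ⟨u, -, rfl⟩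
          exact Submodule.mem_comap.mpr ⟨u, rfl⟩)) := by
  refine ⟨Submodule.inclusion_injective _, ?_, ?_, ?_, ?_⟩
  · rw [Submodule.range_inclusion, LinearMap.ker_comp, Submodule.ker_mkQ]
    ext ⟨x, hx⟩
    simp
  · ext q
    obtain ⟨u, rfl⟩ := V.mkQ_surjective q
    simp only [LinearMap.mem_range, LinearMap.mem_ker, LinearMap.comp_apply,
      Submodule.subtype_apply, Submodule.mkQ_apply, Submodule.mapQ_apply,
      Submodule.Quotient.mk_eq_zero, Submodule.Quotient.eq]
    constructor
    · rintro ⟨⟨y, hy⟩, hyu⟩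
      refine ⟨u - y, by simpa using V.neg_mem hyu, ?_⟩
      rw [map_sub, LinearMap.mem_ker.mp hy, sub_zero]
    · rintro ⟨v, hv, hvu⟩
      refine ⟨⟨u - v, by rw [LinearMap.mem_ker, map_sub, hvu, sub_self]⟩, ?_⟩
      simpa using V.neg_mem hv
  · ext q
    obtain ⟨w, rfl⟩ := (V.map f).mkQ_surjective q
    simp only [LinearMap.mem_range, LinearMap.mem_ker, Submodule.mkQ_apply,
      Submodule.mapQ_apply, LinearMap.id_apply, Submodule.Quotient.mk_eq_zero]
    constructor
    · rintro ⟨p, hp⟩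
      obtain ⟨u, rfl⟩ := V.mkQ_surjective p
      rw [Submodule.mkQ_apply, Submodule.mapQ_apply, Submodule.Quotient.eq] at hp
      obtain ⟨v, -, hv⟩ := hp
      exact ⟨u - v, by rw [map_sub, hv, sub_sub_cancel]⟩
    · rintro ⟨u, rfl⟩
      exact ⟨Submodule.Quotient.mk u, Submodule.mapQ_apply ..⟩
  · intro q
    obtain ⟨w, rfl⟩ := (LinearMap.range f).mkQ_surjective q
    exact ⟨Submodule.Quotient.mk w, Submodule.mapQ_apply ..⟩
end

section
/- Let K be a field, let U and W be K-vector spaces, let f : U → W be a K-linear map, and let V ⊆ U be a linear subspace such that the quotient U / V is finite-dimensional. If ker(f) and W / f(U) are finite-dimensional, then ker(f) ∩ V (which is the kernel of the restriction f|_V) and W / f(V) (the cokernel of f|_V) are also finite-dimensional, and the indices satisfy: dim ker(f) − dim(W / f(U)) = ( dim(ker(f) ∩ V) − dim(W / f(V)) ) + dim(U / V). -/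
/-- If `U/V`, `ker f` and `W/f(U)` are finite-dimensional then so are
`ker f ∩ V` and `W/f(V)`, and
`dim ker f − dim (W/f(U)) = (dim (ker f ∩ V) − dim (W/f(V))) + dim (U/V)`. -/
theorem stmt2 {K U W : Type*} [Field K] [AddCommGroup U] [Module K U]
    [AddCommGroup W] [Module K W] (f : U →ₗ[K] W) (V : Submodule K U)
    [FiniteDimensional K (U ⧸ V)]
    [FiniteDimensional K (LinearMap.ker f)]
    [FiniteDimensional K (W ⧸ LinearMap.range f)] :
    FiniteDimensional K ↥(LinearMap.ker f ⊓ V) ∧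
    FiniteDimensional K (W ⧸ V.map f) ∧
    (Module.finrank K (LinearMap.ker f) : ℤ)
        - Module.finrank K (W ⧸ LinearMap.range f)
      = ((Module.finrank K ↥(LinearMap.ker f ⊓ V) : ℤ)
          - Module.finrank K (W ⧸ V.map f))
        + Module.finrank K (U ⧸ V) := by
  set g : U ⧸ V →ₗ[K] W ⧸ V.map f := V.mapQ (V.map f) f (Submodule.le_comap_map f V) with hg
  have hrange : LinearMap.range g = (LinearMap.range f).map (V.map f).mkQ :=
    Submodule.range_mapQ ..
  have hker : LinearMap.ker g = (LinearMap.ker f).map V.mkQ := by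
    rw [hg, Submodule.mapQ, Submodule.ker_liftQ, LinearMap.ker_comp, Submodule.ker_mkQ,
      Submodule.comap_map_eq, Submodule.map_sup, Submodule.mkQ_map_self, bot_sup_eq]
  let e : ((W ⧸ V.map f) ⧸ LinearMap.range g) ≃ₗ[K] W ⧸ LinearMap.range f :=
    (Submodule.quotEquivOfEq _ _ hrange).trans
      (Submodule.quotientQuotientEquivQuotient _ _ (LinearMap.map_le_range))
  have : FiniteDimensional K ((W ⧸ V.map f) ⧸ LinearMap.range g) := Module.Finite.equiv e.symm
  have hfin : FiniteDimensional K (W ⧸ V.map f) :=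
    Module.Finite.of_submodule_quotient (LinearMap.range g)
  have hg_rank := g.finrank_range_add_finrank_ker
  have hcoker := (LinearMap.range g).finrank_quotient_add_finrank
  rw [e.finrank_eq] at hcoker
  have hrestrict := (V.mkQ.domRestrict (LinearMap.ker f)).finrank_range_add_finrank_ker
  rw [LinearMap.range_domRestrict, LinearMap.ker_domRestrict, ← hker, Submodule.ker_mkQ,
    (Submodule.equivSubtypeMap (LinearMap.ker f) _).finrank_eq, Submodule.map_comap_subtype]
    at hrestrict
  exact ⟨inferInstance, hfin, by lia⟩
end

section
/- Let K be a field and let A₀, A, H₂ be K-vector spaces. Let r : A₀ → A and g : A → H₂ be K-linear maps with g ∘ r = 0, and let V ⊆ A be a linear subspace containing the range of r. Assume that ker(r), ker(g)/range(r), and H₂/g(V) are finite-dimensional. For every subspace B with V ⊆ B ⊆ A set χ(B) := dim ker(r) − dim( (ker(g) ∩ B) / range(r) ) + dim( H₂ / g(B) ), noting that range(r) ⊆ ker(g) ∩ B. Then for every such B the spaces (ker(g) ∩ B)/range(r) and H₂/g(B) are finite-dimensional, and χ is antitone: whenever V ⊆ B ⊆ B' ⊆ A one has χ(B') ≤ χ(B);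 in particular χ(A) ≤ χ(B) ≤ χ(V) for all B with V ⊆ B ⊆ A. -/
/-- For `P ≤ Q`, the map `P / (R ∩ P) → Q / (R ∩ Q)` induced by inclusion is injective. -/
theorem exists_injective_subquotient_of_le {K M : Type*} [Ring K] [AddCommGroup M] [Module K M]
    (R : Submodule K M) {P Q : Submodule K M} (hPQ : P ≤ Q) :
    ∃ f : (↥P ⧸ R.comap P.subtype) →ₗ[K] (↥Q ⧸ R.comap Q.subtype), Function.Injective f := by
  have hcomap : (R.comap Q.subtype).comap (Submodule.inclusion hPQ) = R.comap P.subtype := rfl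
  refine ⟨Submodule.mapQ _ _ (Submodule.inclusion hPQ) hcomap.ge, ?_⟩
  rw [← LinearMap.ker_eq_bot, Submodule.mapQ, Submodule.ker_liftQ, LinearMap.ker_comp,
    Submodule.ker_mkQ, hcomap, Submodule.mkQ_map_self]

/-- For a two-step complex `A₀ →(r) A →(g) H₂` (`g ∘ r = 0`) and a subspace
`V ⊇ range r` with `ker r`, `ker g / range r` and `H₂ / g(V)` finite-dimensional,
the Euler characteristic
`χ(B) = dim ker r − dim((ker g ∩ B)/range r) + dim(H₂/g(B))` is well defined
(i.e. the relevant spaces are finite-dimensional) for every `B` with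
`V ⊆ B ⊆ A`, and `χ` is antitone; in particular `χ(A) ≤ χ(B) ≤ χ(V)`. -/
theorem stmt4 {K A₀ A H₂ : Type*} [Field K]
    [AddCommGroup A₀] [Module K A₀] [AddCommGroup A] [Module K A]
    [AddCommGroup H₂] [Module K H₂]
    (r : A₀ →ₗ[K] A) (g : A →ₗ[K] H₂) (hgr : g ∘ₗ r = 0)
    (V : Submodule K A) (hrV : LinearMap.range r ≤ V)
    [FiniteDimensional K (LinearMap.ker r)]
    [FiniteDimensional K
      (↥(LinearMap.ker g) ⧸
        (LinearMap.range r).comap (LinearMap.ker g).subtype)]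
    [FiniteDimensional K (H₂ ⧸ V.map g)]
    (χ : Submodule K A → ℤ)
    (hχ : ∀ B : Submodule K A, V ≤ B →
      χ B = (Module.finrank K (LinearMap.ker r) : ℤ)
        - Module.finrank K
            (↥(LinearMap.ker g ⊓ B) ⧸
              (LinearMap.range r).comap (LinearMap.ker g ⊓ B).subtype)
        + Module.finrank K (H₂ ⧸ B.map g)) :
    (∀ B : Submodule K A, V ≤ B →
      FiniteDimensional K
        (↥(LinearMap.ker g ⊓ B) ⧸
          (LinearMap.range r).comap (LinearMap.ker g ⊓ B).subtype) ∧
      FiniteDimensional K (H₂ ⧸ B.map g)) ∧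
    (∀ B B' : Submodule K A, V ≤ B → B ≤ B' → χ B' ≤ χ B) ∧
    (∀ B : Submodule K A, V ≤ B → χ ⊤ ≤ χ B ∧ χ B ≤ χ V) := by
  have finite_coker : ∀ B : Submodule K A, V ≤ B → FiniteDimensional K (H₂ ⧸ B.map g) :=
    fun B hB => Module.Finite.of_surjective (Submodule.factor (Submodule.map_mono hB))
      (Submodule.factor_surjective _)
  have finite_middle : ∀ B : Submodule K A, FiniteDimensional K
      (↥(LinearMap.ker g ⊓ B) ⧸
        (LinearMap.range r).comap (LinearMap.ker g ⊓ B).subtype) := fun B => by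
    obtain ⟨f, hf⟩ := exists_injective_subquotient_of_le (LinearMap.range r)
      (inf_le_left : LinearMap.ker g ⊓ B ≤ LinearMap.ker g)
    exact Module.Finite.of_injective f hf
  have antitone : ∀ B B' : Submodule K A, V ≤ B → B ≤ B' → χ B' ≤ χ B := by
    intro B B' hB hBB'
    obtain ⟨f, hf⟩ := exists_injective_subquotient_of_le (LinearMap.range r)
      (inf_le_inf_left (LinearMap.ker g) hBB')
    have := finite_coker B hB
    have := finite_middle B'
    have hmiddle := LinearMap.finrank_le_finrank_of_injective hf
    have hcoker := LinearMap.finrank_le_finrank_of_surjective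
      (Submodule.factor_surjective (Submodule.map_mono (f := g) hBB'))
    rw [hχ B hB, hχ B' (hB.trans hBB')]
    lia
  exact ⟨fun B hB => ⟨finite_middle B, finite_coker B hB⟩, antitone,
    fun B hB => ⟨antitone B ⊤ hB le_top, antitone V B le_rfl hB⟩⟩
end

section
/- Let M, V, E be topological spaces, let π : M → V be a continuous map, and let b : E → V be a covering map with E simply connected. Let P = {(x, z) ∈ M × E : π(x) = b(z)}, equipped with the subspace topology of the product M × E, and let e : P → M be the restriction to P of the first projection. Assume that P is path-connected and that for some point (x₀, z₀) ∈ P the following injectivity condition holds: every loop γ based at x₀ in M such that the loop π ∘ γ in V is homotopic rel endpoints to the constant loop at π(x₀) is itself homotopic rel endpoints to the constant loop at x₀. Then e : P → M is a covering map and P is simply connected. -/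
/-- The base change of an evenly covered point along a continuous map. -/
theorem IsEvenlyCovered.pullback_fst {M V E I : Type*} [TopologicalSpace M] [TopologicalSpace V]
    [TopologicalSpace E] [TopologicalSpace I] {π : M → V} (hπ : Continuous π) {b : E → V} {x : M}
    (h : IsEvenlyCovered b (π x) I) :
    IsEvenlyCovered (fun p : {p : M × E // π p.1 = b p.2} => p.1.1) x I := by
  obtain ⟨hI, U, hxU, hU, -, H, hH⟩ := h
  have hH' (u : U × I) : b (H.symm u).1 = u.1 := by rw [← hH, H.apply_symm_apply]
  refine ⟨hI, π ⁻¹' U, hxU, hU.preimage hπ,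
    (hU.preimage hπ).preimage (continuous_fst.comp continuous_subtype_val), ?_⟩
  refine ⟨{
    toFun := fun p ↦ (⟨p.1.1.1, p.2⟩, (H ⟨p.1.1.2, show b p.1.1.2 ∈ U from p.1.2 ▸ p.2⟩).2)
    invFun := fun q ↦ ⟨⟨(q.1.1, (H.symm (⟨π q.1.1, q.1.2⟩, q.2)).1),
      (hH' (⟨π q.1.1, q.1.2⟩, q.2)).symm⟩, q.1.2⟩
    left_inv := ?_
    right_inv := ?_
    continuous_toFun := by fun_prop
    continuous_invFun := by fun_prop }, fun _ ↦ rfl⟩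
  · rintro ⟨⟨⟨y, z⟩, hyz⟩, hy⟩
    have hz : b z ∈ U := (show π y = b z from hyz) ▸ hy
    have key : ((⟨π y, hy⟩ : U), (H ⟨z, hz⟩).2) = H ⟨z, hz⟩ :=
      Prod.ext (Subtype.ext ((show π y = b z from hyz).trans (hH ⟨z, hz⟩).symm)) rfl
    refine Subtype.ext (Subtype.ext (Prod.ext rfl ?_))
    change (H.symm ((⟨π y, hy⟩ : U), (H ⟨z, hz⟩).2)).1 = z
    rw [key, H.symm_apply_apply]
  · rintro ⟨⟨y, hy⟩, i⟩
    refine Prod.ext rfl ?_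
    change (H (H.symm (⟨π y, hy⟩, i))).2 = i
    rw [H.apply_symm_apply]

/-- The base change of a covering map along a continuous map is a covering map. -/
theorem IsCoveringMap.pullback_fst {M V E : Type*} [TopologicalSpace M] [TopologicalSpace V]
    [TopologicalSpace E] {π : M → V} (hπ : Continuous π) {b : E → V} (hb : IsCoveringMap b) :
    IsCoveringMap (fun p : {p : M × E // π p.1 = b p.2} => p.1.1) :=
  fun x ↦ ((hb (π x)).pullback_fst hπ).to_isEvenlyCovered_preimage

/-- A path-connected space is simply connected if all loops at one point are nullhomotopic. -/
theorem SimplyConnectedSpace.of_loops_nullhomotopic_at {X : Type*} [TopologicalSpace X]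
    [PathConnectedSpace X] (x₀ : X) (h : ∀ γ : Path x₀ x₀, γ.Homotopic (Path.refl x₀)) :
    SimplyConnectedSpace X := by
  refine simply_connected_iff_loops_nullhomotopic.mpr ⟨inferInstance, fun x γ ↦ ?_⟩
  have : Subsingleton (FundamentalGroup X x₀) := by
    refine ⟨fun a b ↦ ?_⟩
    induction a using Path.Homotopic.Quotient.ind with | mk a
    induction b using Path.Homotopic.Quotient.ind with | mk b
    exact Path.Homotopic.Quotient.eq.mpr ((h a).trans (h b).symm)
  have : Subsingleton (FundamentalGroup X x) :=
    (FundamentalGroup.fundamentalGroupMulEquivOfPathConnected x x₀).injective.subsingleton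
  exact Path.Homotopic.Quotient.eq.mp
    (Subsingleton.elim (α := FundamentalGroup X x) (.mk γ) (.mk (Path.refl x)))

/-- Let `π : M → V` be continuous and `b : E → V` a covering map with `E`
simply connected. Let `P = {(x, z) ∈ M × E : π x = b z}` with the subspace
topology and `e : P → M` the first projection. If `P` is path-connected and
`π` induces an injective map on fundamental groups at some point `(x₀, z₀)`
of `P` (every loop at `x₀` whose image under `π` is nullhomotopic is itself
nullhomotopic), then `e` is a covering map and `P` is simply connected. -/
theorem stmt5 {M V E : Type*} [TopologicalSpace M] [TopologicalSpace V]
    [TopologicalSpace E] (π : M → V) (hπ : Continuous π)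
    (b : E → V) (hb : IsCoveringMap b) [SimplyConnectedSpace E]
    [PathConnectedSpace {p : M × E // π p.1 = b p.2}]
    (x₀ : M) (z₀ : E) (hx : π x₀ = b z₀)
    (hinj : ∀ γ : Path x₀ x₀,
      Path.Homotopic (γ.map hπ) (Path.refl (π x₀)) →
        Path.Homotopic γ (Path.refl x₀)) :
    IsCoveringMap (fun p : {p : M × E // π p.1 = b p.2} => p.1.1) ∧
      SimplyConnectedSpace {p : M × E // π p.1 = b p.2} := by
  have he := hb.pullback_fst hπ
  refine ⟨he, .of_loops_nullhomotopic_at ⟨(x₀, z₀), hx⟩ fun γ ↦ ?_⟩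
  have hfst : Path.Homotopic (γ.map he.continuous) (Path.refl x₀) := by
    apply hinj
    have hsnd := (SimplyConnectedSpace.paths_homotopic
      (γ.map (continuous_snd.comp continuous_subtype_val)) (Path.refl z₀)).map
        ⟨b, hb.continuous⟩
    convert! hsnd.pathCast hx hx using 1
    · ext t
      exact (γ t).2
    · ext t
      exact hx
  exact (he.homotopicRel_iff_comp ⟨0, .inl rfl, γ.source⟩).mpr hfst
end
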